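/- arXiv:math/9901065 — 2 statements merged into one kernel-verified Lean document; each statement's English description precedes it below -/
import Mathlib

section
/- Let V be a purely even restricted vertex algebra with A = V₀ and V₁ as above. Then for a ∈ A and x, y ∈ V₁: (ax)_{(0)}y = a(x_{(0)}y) - π(y)(a)·x + ⟨x,y⟩·da - d(π(x)π(y)(a)). -/
open scoped BigOperators

/-- The generalized binomial coefficient `C(m, j)` for `m ∈ ℤ`, as a complex number. -/
noncomputable def binom (m : ℤ) (j : ℕ) : ℂ :=
  (∏ i ∈ Finset.range j, ((m : ℂ) - (i : ℂ))) / (Nat.factorial j : ℂ)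

/-- A purely even restricted graded vertex algebra: a vertex algebra (vacuum, Fourier modes
`coeff a n = a_{(n)}`, translation operator `T = ∂`, vacuum axiom, translation invariance and
the Borcherds identity) together with a grading by conformal weights `wt : ℤ → Submodule ℂ V`
(the eigenspace decomposition of the Hamiltonian `H`), with no negative conformal weights,
`vac` of weight `0`, and such that `a_{(n)} : V_Δ ⊗ V_{Δ'} → V_{Δ+Δ'-n-1}`. -/
structure RestrictedVA (V : Type*) [AddCommGroup V] [Module ℂ V] where
  vac : V
  coeff : V → ℤ → Module.End ℂ V
  T : Module.End ℂ V
  wt : ℤ → Submodule ℂ V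
  coeff_add : ∀ (a b : V) (n : ℤ), coeff (a + b) n = coeff a n + coeff b n
  coeff_smul : ∀ (c : ℂ) (a : V) (n : ℤ), coeff (c • a) n = c • coeff a n
  truncation : ∀ a b : V, ∃ N : ℤ, ∀ n ≥ N, coeff a n b = 0
  vac_field : ∀ n : ℤ, coeff vac n = if n = -1 then (1 : Module.End ℂ V) else 0
  T_vac : T vac = 0
  creation_nonneg : ∀ (a : V) (n : ℤ), 0 ≤ n → coeff a n vac = 0
  creation_neg_one : ∀ a : V, coeff a (-1) vac = a
  translation : ∀ (a : V) (n : ℤ),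
    T * coeff a n - coeff a n * T = ((-n : ℤ) : ℂ) • coeff a (n - 1)
  borcherds : ∀ (a b c : V) (m n k : ℤ),
    (∑ᶠ j : ℕ, binom m j • coeff (coeff a (n + j) b) (m + k - j) c) =
      (∑ᶠ j : ℕ, ((-1 : ℂ) ^ j * binom n j) • coeff a (n + m - j) (coeff b (k + j) c)) -
      (∑ᶠ j : ℕ, ((-1 : ℂ) ^ ((j : ℤ) + n) * binom n j) •
        coeff b (n + k - j) (coeff a (m + j) c))
  wt_neg : ∀ d : ℤ, d < 0 → wt d = ⊥
  vac_wt : vac ∈ wt 0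
  wt_indep : ∀ d : ℤ, Disjoint (wt d) (⨆ (e : ℤ) (_ : e ≠ d), wt e)
  wt_top : (⨆ d : ℤ, wt d) = ⊤
  wt_coeff : ∀ {a b : V} {d e : ℤ} (n : ℤ),
    a ∈ wt d → b ∈ wt e → coeff a n b ∈ wt (d + e - n - 1)

/-- The subspace `Ω ⊆ V₁` spanned by the elements `a ∂b` with `a, b ∈ A = V₀`
(the product being `a_{(-1)}`). -/
def RestrictedVA.Omega {V : Type*} [AddCommGroup V] [Module ℂ V] (W : RestrictedVA V) :
    Submodule ℂ V :=
  Submodule.span ℂ {x | ∃ a b : V, a ∈ W.wt 0 ∧ b ∈ W.wt 0 ∧ x = W.coeff a (-1) (W.T b)}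

theorem finsum_eq_zero_add_one {M : Type*} [AddCommMonoid M] {f : ℕ → M}
    (h : ∀ j, 2 ≤ j → f j = 0) : ∑ᶠ j, f j = f 0 + f 1 := by
  rw [finsum_eq_sum_of_support_subset (s := Finset.range 2) f, Finset.sum_range_succ,
    Finset.sum_range_one]
  intro j hj
  by_contra hj'
  exact hj (h j (by simpa [Nat.lt_iff_add_one_le] using hj'))

theorem binom_zero_right (m : ℤ) : binom m 0 = 1 := by simp [binom]

theorem binom_one_right (m : ℤ) : binom m 1 = m := by simp [binom]

namespace RestrictedVA

variable {V : Type*} [AddCommGroup V] [Module ℂ V] (W : RestrictedVA V)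

theorem coeff_zero_left (n : ℤ) : W.coeff 0 n = 0 := by
  simpa using W.coeff_smul 0 0 n

theorem coeff_neg_two_vac (a : V) : W.coeff a (-2) W.vac = W.T a := by
  have h := LinearMap.congr_fun (W.translation a (-1)) W.vac
  simpa [W.T_vac, W.creation_neg_one] using h.symm

theorem coeff_eq_zero {a b : V} {d e n : ℤ} (ha : a ∈ W.wt d) (hb : b ∈ W.wt e)
    (h : d + e - n - 1 < 0) : W.coeff a n b = 0 := by
  have hab := W.wt_coeff n ha hb
  rwa [W.wt_neg _ h, Submodule.mem_bot] at hab

/-- Skew-symmetry `b_{(n)}a = (-1)^{n+1} ∑ⱼ (-1)^j ∂^j/j! (a_{(n+j)}b)` when at most the first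
two terms are nonzero. -/
theorem skew_symmetry {a b : V} {n : ℤ} (h : ∀ j, n + 2 ≤ j → W.coeff a j b = 0) :
    W.coeff b n a = (-1 : ℂ) ^ (n + 1) • (W.coeff a n b - W.T (W.coeff a (n + 1) b)) := by
  have key := W.borcherds a b W.vac (-1) n 0
  have hvac (u : V) {j : ℕ} (hj : 2 ≤ j) : W.coeff u (-1 + j) W.vac = 0 :=
    W.creation_nonneg u _ (by omega)
  rw [finsum_eq_zero_add_one fun j hj => by
      rw [h _ (by omega), coeff_zero_left, LinearMap.zero_apply, smul_zero],
    finsum_eq_zero_add_one fun j _ => by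
      rw [W.creation_nonneg b _ (by omega), map_zero, smul_zero],
    finsum_eq_zero_add_one fun j hj => by rw [hvac a hj, map_zero, smul_zero]] at key
  simp only [binom_zero_right, binom_one_right, Nat.cast_zero, Nat.cast_one, add_zero, sub_zero,
    zero_add, neg_add_cancel, W.creation_neg_one, W.creation_nonneg _ _ le_rfl,
    W.creation_nonneg _ _ zero_le_one, map_zero, smul_zero, mul_one, one_smul, zero_sub] at key
  rw [show (-1 - 1 : ℤ) = -2 by norm_num, W.coeff_neg_two_vac] at key
  have hsign : (-1 : ℂ) ^ (n + 1) * (-1 : ℂ) ^ n = -1 := by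
    rw [zpow_add_one₀ (by norm_num), mul_right_comm, ← mul_zpow]
    norm_num
  have hsub : W.coeff a n b - W.T (W.coeff a (n + 1) b) = -((-1 : ℂ) ^ n • W.coeff b n a) := by
    rw [← key]
    push_cast
    module
  rw [hsub, smul_neg, smul_smul, hsign, neg_one_smul, neg_neg]

theorem coeff_neg_two_eq {a f : V} (ha : a ∈ W.wt 0) (hf : f ∈ W.wt 0) :
    W.coeff a (-2) f = W.coeff f (-1) (W.T a) := by
  have h := LinearMap.congr_fun (W.translation f (-1)) a
  norm_num at h
  rw [W.skew_symmetry fun j hj => W.coeff_eq_zero hf ha (by omega)]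
  norm_num
  rw [← h]
  abel

theorem coeff_zero_eq_neg {a y : V} (ha : a ∈ W.wt 0) (hy : y ∈ W.wt 1) :
    W.coeff a 0 y = -W.coeff y 0 a := by
  rw [W.skew_symmetry fun j hj => W.coeff_eq_zero hy ha (by omega),
    W.coeff_eq_zero (n := 0 + 1) hy ha (by norm_num)]
  simp

theorem coeff_neg_one_eq {b x : V} (hb : b ∈ W.wt 0) (hx : x ∈ W.wt 1) :
    W.coeff x (-1) b = W.coeff b (-1) x + W.T (W.coeff x 0 b) := by
  rw [W.skew_symmetry fun j hj => W.coeff_eq_zero hb hx (by omega)]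
  simp [W.coeff_zero_eq_neg hb hx]

theorem coeff_coeff_neg_one_zero {a x y : V}
    (ha : a ∈ W.wt 0) (hx : x ∈ W.wt 1) (hy : y ∈ W.wt 1) :
    W.coeff (W.coeff a (-1) x) 0 y =
      W.coeff a (-1) (W.coeff x 0 y) + W.coeff a (-2) (W.coeff x 1 y)
        + W.coeff x (-1) (W.coeff a 0 y) := by
  have key := W.borcherds a x y 0 (-1) 0
  rw [finsum_eq_zero_add_one fun j hj => by
      rw [W.coeff_eq_zero ha hx (by omega), coeff_zero_left, LinearMap.zero_apply, smul_zero],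
    finsum_eq_zero_add_one fun j hj => by
      rw [W.coeff_eq_zero hx hy (by omega), map_zero, smul_zero],
    finsum_eq_zero_add_one fun j hj => by
      rw [W.coeff_eq_zero ha hy (by omega), map_zero, smul_zero]] at key
  simpa [binom_zero_right, binom_one_right, W.coeff_eq_zero (n := 1) ha hy (by norm_num)]
    using key

end RestrictedVA

/-- In a purely even restricted vertex algebra, for `a ∈ A = V₀` and
`x, y ∈ V₁`:
`(ax)_{(0)}y = a(x_{(0)}y) - π(y)(a)·x + ⟨x,y⟩·da - d(π(x)π(y)(a))`,
where `ax = a_{(-1)}x`, `⟨x,y⟩ = x_{(1)}y`, `π(x)(a) = x_{(0)}a`, `d = ∂`. -/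
theorem zero_mode_of_product {V : Type*} [AddCommGroup V] [Module ℂ V]
    (W : RestrictedVA V) (a x y : V)
    (ha : a ∈ W.wt 0) (hx : x ∈ W.wt 1) (hy : y ∈ W.wt 1) :
    W.coeff (W.coeff a (-1) x) 0 y =
      W.coeff a (-1) (W.coeff x 0 y) - W.coeff (W.coeff y 0 a) (-1) x
        + W.coeff (W.coeff x 1 y) (-1) (W.T a) - W.T (W.coeff x 0 (W.coeff y 0 a)) := by
  have hya : W.coeff y 0 a ∈ W.wt 0 := by simpa using W.wt_coeff 0 hy ha
  have hxy : W.coeff x 1 y ∈ W.wt 0 := by simpa using W.wt_coeff 1 hx hy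
  rw [W.coeff_coeff_neg_one_zero ha hx hy, W.coeff_neg_two_eq ha hxy, W.coeff_zero_eq_neg ha hy,
    map_neg, W.coeff_neg_one_eq hya hx]
  abel
end

section
/- Let V be a vertex algebra and f, g ∈ Fields(V) mutually local fields, i.e., (z-w)^N[f(z), g(w)] = 0 for some N ≥ 0. Then for j ≥ 0 the j-th product f(z)_{(j)}g(z) := Res_w [f(w), g(z)](w-z)^j is again a field, and for j ≥ N it vanishes. -/
/-- The binomial sum giving the coefficients of `(z - w) ^ j c(z, w)` satisfies the recursion coming
from `(z - w) ^ (j + 1) = z (z - w) ^ j - w (z - w) ^ j`. -/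
theorem sum_neg_one_pow_choose_succ {A : Type*} [AddCommGroup A] (c : ℤ → ℤ → A) (j : ℕ)
    (p q : ℤ) :
    ∑ i ∈ Finset.range (j + 1 + 1), ((-1 : ℤ) ^ i * ((j + 1).choose i : ℤ)) •
        c (p + ((j + 1 : ℕ) : ℤ) - i) (q + i) =
      ∑ i ∈ Finset.range (j + 1), ((-1 : ℤ) ^ i * (j.choose i : ℤ)) •
        c (p + 1 + (j : ℤ) - i) (q + i) -
      ∑ i ∈ Finset.range (j + 1), ((-1 : ℤ) ^ i * (j.choose i : ℤ)) •
        c (p + (j : ℤ) - i) (q + 1 + i) := by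
  have extend : ∑ i ∈ Finset.range (j + 1), ((-1 : ℤ) ^ i * (j.choose i : ℤ)) •
        c (p + 1 + (j : ℤ) - i) (q + i) =
      ∑ i ∈ Finset.range (j + 1 + 1), ((-1 : ℤ) ^ i * (j.choose i : ℤ)) •
        c (p + 1 + (j : ℤ) - i) (q + i) := by
    rw [Finset.sum_range_succ _ (j + 1)]
    simp
  rw [extend, Finset.sum_range_succ', Finset.sum_range_succ' _ (j + 1),
    add_sub_right_comm (Finset.sum _ _), ← Finset.sum_sub_distrib]
  congr 1
  · refine Finset.sum_congr rfl fun i _ => ?_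
    have h₁ : p + ((j + 1 : ℕ) : ℤ) - ((i + 1 : ℕ) : ℤ) = p + j - i := by push_cast; ring
    have h₂ : p + 1 + (j : ℤ) - ((i + 1 : ℕ) : ℤ) = p + j - i := by push_cast; ring
    have h₃ : q + ((i + 1 : ℕ) : ℤ) = q + 1 + i := by push_cast; ring
    rw [h₁, h₂, h₃, ← sub_smul, Nat.choose_succ_succ]
    congr 1
    push_cast
    ring
  · have h : p + ((j + 1 : ℕ) : ℤ) = p + 1 + j := by push_cast; ring
    rw [h, Nat.choose_zero_right, Nat.choose_zero_right]

/-- If `(z - w) ^ N` annihilates a formal distribution in two variables, so does `(z - w) ^ j`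
for every `j ≥ N`. -/
theorem sum_neg_one_pow_choose_eq_zero_of_le {A : Type*} [AddCommGroup A] (c : ℤ → ℤ → A)
    {N j : ℕ} (hNj : N ≤ j)
    (hc : ∀ p q : ℤ, ∑ i ∈ Finset.range (N + 1), ((-1 : ℤ) ^ i * (N.choose i : ℤ)) •
      c (p + (N : ℤ) - i) (q + i) = 0) (p q : ℤ) :
    ∑ i ∈ Finset.range (j + 1), ((-1 : ℤ) ^ i * (j.choose i : ℤ)) •
      c (p + (j : ℤ) - i) (q + i) = 0 := by
  induction j, hNj using Nat.le_induction generalizing p q with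
  | base => exact hc p q
  | succ j _ ih => rw [sum_neg_one_pow_choose_succ, ih, ih, sub_zero]

/-- Let `f, g` be mutually local fields on `V`, i.e. families of endomorphisms
`f n = f_{(n)}` satisfying the field (truncation) condition and
`(z-w)^N [f(z), g(w)] = 0` (expressed coefficientwise).  Then for `j ≥ 0` the `j`-th product
`f(z)_{(j)} g(z) := Res_w [f(w), g(z)] (w-z)^j`, whose `n`-th Fourier mode is
`Σ_{i=0}^{j} (-1)^i C(j,i) [f_{(j-i)}, g_{(n+i)}]`, is again a field, and it vanishes
identically for `j ≥ N`. -/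
theorem local_fields_nth_product {V : Type*} [AddCommGroup V] [Module ℂ V]
    (f g : ℤ → Module.End ℂ V)
    (hf : ∀ a : V, ∃ M : ℤ, ∀ n ≥ M, f n a = 0)
    (hg : ∀ a : V, ∃ M : ℤ, ∀ n ≥ M, g n a = 0)
    (N : ℕ)
    (hloc : ∀ p q : ℤ,
      (∑ i ∈ Finset.range (N + 1), ((-1 : ℤ) ^ i * (N.choose i : ℤ)) •
        (f (p + (N : ℤ) - i) * g (q + i) - g (q + i) * f (p + (N : ℤ) - i))) = 0) :
    ∀ j : ℕ,
      (∀ a : V, ∃ M : ℤ, ∀ n ≥ M,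
        (∑ i ∈ Finset.range (j + 1), ((-1 : ℤ) ^ i * (j.choose i : ℤ)) •
          (f ((j : ℤ) - i) * g (n + i) - g (n + i) * f ((j : ℤ) - i))) a = 0) ∧
      (N ≤ j → ∀ n : ℤ,
        (∑ i ∈ Finset.range (j + 1), ((-1 : ℤ) ^ i * (j.choose i : ℤ)) •
          (f ((j : ℤ) - i) * g (n + i) - g (n + i) * f ((j : ℤ) - i))) = 0) := by
  intro j
  refine ⟨fun a => ?_, fun hNj n => ?_⟩
  · obtain ⟨M, hM⟩ := hg a
    choose K hK using fun i : ℕ => hg (f ((j : ℤ) - i) a)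
    obtain ⟨B, hB⟩ := ((Finset.range (j + 1)).image K).bddAbove
    refine ⟨max M B, fun n hn => ?_⟩
    rw [LinearMap.sum_apply]
    refine Finset.sum_eq_zero fun i hi => ?_
    have hKB : K i ≤ B := hB (Finset.mem_coe.2 (Finset.mem_image_of_mem K hi))
    have h₁ : g (n + i) a = 0 := hM _ (by omega)
    have h₂ : g (n + i) (f ((j : ℤ) - i) a) = 0 := hK i _ (by omega)
    rw [LinearMap.smul_apply, LinearMap.sub_apply, Module.End.mul_apply, Module.End.mul_apply,
      h₁, h₂, map_zero, sub_zero, smul_zero]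
  · simpa only [zero_add] using
      sum_neg_one_pow_choose_eq_zero_of_le (fun m k => f m * g k - g k * f m) hNj hloc 0 n
end
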